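/- arXiv:1410.2113 — 2 statements merged into one kernel-verified Lean document; each statement's English description precedes it below -/
import Mathlib

section
/- Let $\alpha > 0$ be a non-integer real number and let $q_j$ for $j \ge 1$ be as defined. Then for every $t > 1$, the series of non-negative terms $\sum_{j=1}^{\infty} q_j(t)$ diverges, i.e. $\lim_{J \to \infty} \sum_{j=1}^{J} q_j(t) = +\infty$. -/
open Filter MeasureTheory

/-- Generalized binomial coefficients: `a α 0 = 1`,
`a α k = α (α-1) ⋯ (α-k+1) / k!` for `k ≥ 1`. -/
noncomputable def a (α : ℝ) (k : ℕ) : ℝ :=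
  (∏ i ∈ Finset.range k, (α - i)) / (Nat.factorial k : ℝ)

/-- For `j ≥ 1`,
`q_j(t) = (1/2) a_{⌊α⌋+2j-1} t^{2(⌊α⌋+2j-1)} + a_{⌊α⌋+2j} t^{2(⌊α⌋+2j)}
  + (1/2) a_{⌊α⌋+2j+1} t^{2(⌊α⌋+2j+1)}`. -/
noncomputable def qj (α : ℝ) (j : ℕ) (t : ℝ) : ℝ :=
  (1 / 2) * a α (⌊α⌋₊ + 2 * j - 1) * t ^ (2 * (⌊α⌋₊ + 2 * j - 1)) +
    a α (⌊α⌋₊ + 2 * j) * t ^ (2 * (⌊α⌋₊ + 2 * j)) +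
    (1 / 2) * a α (⌊α⌋₊ + 2 * j + 1) * t ^ (2 * (⌊α⌋₊ + 2 * j + 1))

/-- The ratio `a α (k + 1) / a α k` of consecutive generalized binomial coefficients. -/
noncomputable def binomRatio (α : ℝ) (k : ℕ) : ℝ :=
  (α - k) / (k + 1)

theorem a_succ (α : ℝ) (k : ℕ) : a α (k + 1) = a α k * binomRatio α k := by
  have hk : (k.factorial : ℝ) ≠ 0 := by positivity
  have hk1 : (k : ℝ) + 1 ≠ 0 := by positivity
  unfold a binomRatio
  rw [Finset.prod_range_succ, Nat.factorial_succ]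
  push_cast
  field_simp

theorem tendsto_binomRatio (α : ℝ) : Tendsto (binomRatio α) atTop (nhds (-1)) := by
  have h : Tendsto (fun k : ℕ => (α + 1) * (1 / ((k : ℝ) + 1)) - 1) atTop (nhds (-1)) := by
    simpa using (tendsto_one_div_add_atTop_nhds_zero_nat.const_mul (α + 1)).sub_const 1
  refine h.congr fun k => ?_
  have hk1 : (k : ℝ) + 1 ≠ 0 := by positivity
  unfold binomRatio
  field_simp
  ring

theorem binomRatio_neg {α : ℝ} {k : ℕ} (h : α < k) : binomRatio α k < 0 :=
  div_neg_of_neg_of_pos (sub_neg.2 h) (by positivity)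

theorem a_pos_of_forall_lt {α : ℝ} {k : ℕ} (h : ∀ i < k, (i : ℝ) < α) : 0 < a α k :=
  div_pos (Finset.prod_pos fun i hi => sub_pos.2 (h i (Finset.mem_range.1 hi))) (by positivity)

theorem a_floor_add_odd_pos {α : ℝ} (hα0 : 0 < α) (hαni : ∀ n : ℤ, α ≠ (n : ℝ)) (j : ℕ) :
    0 < a α (⌊α⌋₊ + 2 * j + 1) := by
  induction j with
  | zero =>
    refine a_pos_of_forall_lt fun i hi => ?_
    have hle : (i : ℝ) ≤ α := (Nat.le_floor_iff hα0.le).1 (by omega)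
    exact lt_of_le_of_ne hle fun h => hαni i (by simp [h])
  | succ j ih =>
    have hlt (i : ℕ) : α < ((⌊α⌋₊ + 1 + i : ℕ) : ℝ) :=
      (Nat.floor_lt hα0.le).1 (by omega)
    have h₁ : binomRatio α (⌊α⌋₊ + 2 * j + 1) < 0 :=
      binomRatio_neg (by convert hlt (2 * j) using 2; ring)
    have h₂ : binomRatio α (⌊α⌋₊ + 2 * j + 1 + 1) < 0 :=
      binomRatio_neg (by convert hlt (2 * j + 1) using 2; ring)
    rw [show ⌊α⌋₊ + 2 * (j + 1) + 1 = ⌊α⌋₊ + 2 * j + 1 + 1 + 1 by ring, a_succ, a_succ, mul_assoc]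
    exact mul_pos ih (mul_pos_of_neg_of_neg h₁ h₂)

theorem qj_succ (α t : ℝ) (j : ℕ) :
    qj α (j + 1) t = a α (⌊α⌋₊ + 2 * j + 1) * (t ^ 2) ^ (⌊α⌋₊ + 2 * j + 1) *
      (1 / 2 + binomRatio α (⌊α⌋₊ + 2 * j + 1) * t ^ 2 + 1 / 2 *
        (binomRatio α (⌊α⌋₊ + 2 * j + 1) * binomRatio α (⌊α⌋₊ + 2 * j + 1 + 1) * (t ^ 2) ^ 2)) := by
  unfold qj
  rw [show ⌊α⌋₊ + 2 * (j + 1) - 1 = ⌊α⌋₊ + 2 * j + 1 by omega,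
    show ⌊α⌋₊ + 2 * (j + 1) = ⌊α⌋₊ + 2 * j + 1 + 1 by ring]
  simp only [a_succ α (⌊α⌋₊ + 2 * j + 1), a_succ α (⌊α⌋₊ + 2 * j + 1 + 1), pow_mul]
  ring

theorem tendsto_sum_Icc_atTop_of_le {f : ℕ → ℝ} {c : ℝ} (hc : 0 < c)
    (h : ∀ᶠ j in atTop, c ≤ f (j + 1)) :
    Tendsto (fun J : ℕ => ∑ j ∈ Finset.Icc 1 J, f j) atTop atTop := by
  obtain ⟨N, hN⟩ := eventually_atTop.1 h
  rw [← tendsto_add_atTop_iff_nat N]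
  have hle (k : ℕ) : ∑ j ∈ Finset.Icc 1 N, f j + k * c ≤ ∑ j ∈ Finset.Icc 1 (k + N), f j := by
    induction k with
    | zero => simp
    | succ k ih =>
      rw [show k + 1 + N = k + N + 1 by ring, Finset.sum_Icc_succ_top (by omega)]
      have := hN (k + N) (by omega)
      push_cast
      linarith
  exact tendsto_atTop_mono hle
    (tendsto_atTop_add_const_left _ _ (tendsto_natCast_atTop_atTop.atTop_mul_const hc))

/-- For non-integer `α > 0` and `t > 1`, the series `∑_{j≥1} q_j(t)` of
non-negative terms diverges: its partial sums tend to `+∞`. -/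
theorem stmt_7 (α : ℝ) (hα0 : 0 < α) (hαni : ∀ n : ℤ, α ≠ (n : ℝ))
    (t : ℝ) (ht : 1 < t) :
    Tendsto (fun J : ℕ => ∑ j ∈ Finset.Icc 1 J, qj α j t) atTop atTop := by
  set s := t ^ 2
  have hs1 : 1 < s := one_lt_pow₀ ht two_ne_zero
  set B : ℕ → ℝ := fun j => a α (⌊α⌋₊ + 2 * j + 1) * s ^ (⌊α⌋₊ + 2 * j + 1) with hB
  have hBpos (j : ℕ) : 0 < B j := mul_pos (a_floor_add_odd_pos hα0 hαni j) (by positivity)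
  have hindex : Tendsto (fun j : ℕ => ⌊α⌋₊ + 2 * j + 1) atTop atTop :=
    tendsto_atTop_mono (fun j => show j ≤ _ by omega) tendsto_id
  have hx := (tendsto_binomRatio α).comp hindex
  have hy := (tendsto_binomRatio α).comp ((tendsto_add_atTop_nat 1).comp hindex)
  have hxy := (hx.mul hy).mul_const (s ^ 2)
  have hbracket := ((hx.mul_const s).const_add (1 / 2)).add (hxy.const_mul (1 / 2))
  have hδ : 0 < (s - 1) ^ 2 / 4 := by
    have := sub_pos.2 hs1
    positivity
  have hgrow := hxy.eventually_const_lt (u := 1) (by nlinarith)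
  have hlower := hbracket.eventually_const_lt (u := (s - 1) ^ 2 / 4) (by nlinarith)
  obtain ⟨N, hN⟩ := eventually_atTop.1 hgrow
  have hBge : ∀ j ≥ N, B N ≤ B j := by
    intro j hj
    induction j, hj using Nat.le_induction with
    | base => exact le_rfl
    | succ j hj ih =>
      refine ih.trans ?_
      have hstep : B (j + 1) = B j * (binomRatio α (⌊α⌋₊ + 2 * j + 1) *
          binomRatio α (⌊α⌋₊ + 2 * j + 1 + 1) * s ^ 2) := by
        simp only [hB]
        rw [show ⌊α⌋₊ + 2 * (j + 1) + 1 = ⌊α⌋₊ + 2 * j + 1 + 1 + 1 by ring, a_succ, a_succ]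
        ring
      rw [hstep]
      exact le_mul_of_one_le_right (hBpos j).le (hN j hj).le
  refine tendsto_sum_Icc_atTop_of_le (mul_pos (hBpos N) hδ) ?_
  filter_upwards [hlower, eventually_ge_atTop N] with j hj hjN
  rw [qj_succ]
  exact mul_le_mul (hBge j hjN) hj.le hδ.le (hBpos j).le
end

section
/- Let $d \ge 1$, let $\alpha > d/2$ be a non-integer real number, $\kappa > 0$, and $a_0 = 1$, $a_k = \alpha(\alpha-1)\cdots(\alpha-k+1)/k!$ for $k \ge 1$. Then for every integer $J \ge 1$ and $K = \lfloor\alpha\rfloor + 2J + 1$, the function $\xi \mapsto \left( \sum_{k=0}^{K} a_k\, \kappa^{2(\alpha-k)}\, |\xi|^{2k} \right)^{-1}$ is Lebesgue integrable on $\mathbb{R}^d$, and in particular the denominator is strictly positive for all $\xi \in \mathbb{R}^d$. -/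
open Filter MeasureTheory

theorem a_zero (α : ℝ) : a α 0 = 1 := by
  simp [a]

theorem a_succ_eq_mul_sub (α : ℝ) (k : ℕ) :
    a α (k + 1) = a α k * (α - k) / (k + 1) := by
  have : (k.factorial : ℝ) ≠ 0 := by positivity
  have : (k : ℝ) + 1 ≠ 0 := by positivity
  simp only [a, Finset.prod_range_succ, Nat.factorial_succ]
  push_cast
  field_simp

theorem succ_mul_a_succ (α : ℝ) (k : ℕ) :
    ((k : ℝ) + 1) * a α (k + 1) = α * a (α - 1) k := by
  have : (k.factorial : ℝ) ≠ 0 := by positivity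
  have : (k : ℝ) + 1 ≠ 0 := by positivity
  have hprod : ∏ i ∈ Finset.range k, (α - ((i + 1 : ℕ) : ℝ)) =
      ∏ i ∈ Finset.range k, (α - 1 - i) :=
    Finset.prod_congr rfl fun i _ => by push_cast; ring
  simp only [a, Finset.prod_range_succ', Nat.factorial_succ, hprod]
  push_cast
  field_simp
  ring

/-- The remainder of the binomial series of `(1 + x) ^ α` on `x ≥ 0` has the sign of the first
omitted coefficient. -/
theorem a_mul_binomial_remainder_nonneg (m : ℕ) (α x : ℝ) (hx : 0 ≤ x) :
    0 ≤ a α m * ((1 + x) ^ α - ∑ k ∈ Finset.range m, a α k * x ^ k) := by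
  induction m generalizing α x with
  | zero => simp only [a_zero, Finset.range_zero, Finset.sum_empty, sub_zero]; positivity
  | succ m ih =>
    have hderiv : ∀ y : ℝ, 0 ≤ y → HasDerivAt
        (fun z => a α (m + 1) * ((1 + z) ^ α - ∑ k ∈ Finset.range (m + 1), a α k * z ^ k))
        (a α (m + 1) *
          (α * ((1 + y) ^ (α - 1) - ∑ k ∈ Finset.range m, a (α - 1) k * y ^ k))) y := by
      intro y hy
      have hpow : HasDerivAt (fun z : ℝ => (1 + z) ^ α) (α * (1 + y) ^ (α - 1)) y := by
        have h := ((hasDerivAt_id y).const_add 1).rpow_const (p := α)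
          (Or.inl (by simp only [id]; positivity))
        simpa only [one_mul, id] using h
      have hsum : HasDerivAt (fun z : ℝ => ∑ k ∈ Finset.range (m + 1), a α k * z ^ k)
          (∑ k ∈ Finset.range (m + 1), a α k * (k * y ^ (k - 1))) y :=
        HasDerivAt.fun_sum fun k _ => (hasDerivAt_pow k y).const_mul (a α k)
      refine ((hpow.sub hsum).const_mul (a α (m + 1))).congr_deriv ?_
      congr 1
      rw [mul_sub, Finset.sum_range_succ', Finset.mul_sum]
      simp only [Nat.cast_zero, zero_mul, mul_zero, add_zero, Nat.add_sub_cancel]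
      congr 1
      refine Finset.sum_congr rfl fun k _ => ?_
      push_cast
      linear_combination y ^ k * succ_mul_a_succ α k
    have hmono : MonotoneOn
        (fun z => a α (m + 1) * ((1 + z) ^ α - ∑ k ∈ Finset.range (m + 1), a α k * z ^ k))
        (Set.Ici 0) := by
      refine monotoneOn_of_hasDerivWithinAt_nonneg (convex_Ici 0)
        (fun y hy => (hderiv y hy).continuousAt.continuousWithinAt)
        (fun y hy => (hderiv y (interior_subset hy)).hasDerivWithinAt) fun y hy => ?_
      have hcoef : a α (m + 1) = α * a (α - 1) m / (m + 1) := by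
        rw [eq_div_iff (by positivity), ← succ_mul_a_succ, mul_comm]
      have hstep := ih (α - 1) y (interior_subset hy)
      calc (0 : ℝ) ≤ α ^ 2 / (m + 1) * (a (α - 1) m *
            ((1 + y) ^ (α - 1) - ∑ k ∈ Finset.range m, a (α - 1) k * y ^ k)) := by positivity
        _ = _ := by rw [hcoef]; ring
    have h := hmono (Set.mem_Ici.2 le_rfl) (Set.mem_Ici.2 hx) hx
    simpa [Finset.sum_range_succ', a_zero] using h

/-- The binomial coefficients of a non-integer `α` alternate in sign past `⌊α⌋ + 1`. -/
theorem neg_one_pow_mul_a_pos {α : ℝ} (hα : 0 ≤ α) (hne : α ≠ (⌊α⌋₊ : ℝ)) (j : ℕ) :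
    0 < (-1) ^ j * a α (⌊α⌋₊ + 1 + j) := by
  induction j with
  | zero =>
    simp only [pow_zero, one_mul, add_zero]
    refine a_pos_of_forall_lt fun i hi => ?_
    have hle : (i : ℝ) ≤ ⌊α⌋₊ := by exact_mod_cast Nat.lt_succ_iff.1 hi
    exact hle.trans_lt ((Nat.floor_le hα).lt_of_ne' hne)
  | succ j ih =>
    have hlt : 0 < ((⌊α⌋₊ + 1 + j : ℕ) : ℝ) - α := by
      push_cast
      linarith [Nat.lt_floor_add_one α, (Nat.cast_nonneg j : (0 : ℝ) ≤ j)]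
    rw [← add_assoc, a_succ_eq_mul_sub]
    calc (0 : ℝ) < (-1) ^ j * a α (⌊α⌋₊ + 1 + j) * (((⌊α⌋₊ + 1 + j : ℕ) : ℝ) - α) /
          (((⌊α⌋₊ + 1 + j : ℕ) : ℝ) + 1) := by positivity
      _ = _ := by rw [pow_succ]; ring

theorem one_add_rpow_le_truncated_binomial {α : ℝ} (hα : 0 ≤ α) (hne : α ≠ (⌊α⌋₊ : ℝ)) (J : ℕ)
    {x : ℝ} (hx : 0 ≤ x) :
    (1 + x) ^ α ≤ ∑ k ∈ Finset.range (⌊α⌋₊ + 2 * J + 1 + 1), a α k * x ^ k := by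
  have hneg : a α (⌊α⌋₊ + 2 * J + 1 + 1) < 0 := by
    have h := neg_one_pow_mul_a_pos hα hne (2 * J + 1)
    rw [show ⌊α⌋₊ + 1 + (2 * J + 1) = ⌊α⌋₊ + 2 * J + 1 + 1 by ring, pow_succ, pow_mul] at h
    simpa using h
  exact sub_nonpos.1 (nonpos_of_mul_nonneg_right
    (a_mul_binomial_remainder_nonneg (⌊α⌋₊ + 2 * J + 1 + 1) α x hx) hneg)

theorem add_sq_rpow_le_truncated_symbol {α κ : ℝ} (hα : 0 ≤ α) (hne : α ≠ (⌊α⌋₊ : ℝ))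
    (hκ : 0 < κ) (J : ℕ) (r : ℝ) :
    (κ ^ 2 + r ^ 2) ^ α ≤ ∑ k ∈ Finset.range (⌊α⌋₊ + 2 * J + 1 + 1),
      a α k * κ ^ (2 * (α - (k : ℝ))) * r ^ (2 * k) := by
  have hsum : ∑ k ∈ Finset.range (⌊α⌋₊ + 2 * J + 1 + 1),
      a α k * κ ^ (2 * (α - (k : ℝ))) * r ^ (2 * k) =
      (κ ^ 2) ^ α * ∑ k ∈ Finset.range (⌊α⌋₊ + 2 * J + 1 + 1), a α k * (r ^ 2 / κ ^ 2) ^ k := by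
    rw [Finset.mul_sum]
    refine Finset.sum_congr rfl fun k _ => ?_
    have hpow : κ ^ (2 * (α - (k : ℝ))) = (κ ^ 2) ^ α / (κ ^ 2) ^ k := by
      rw [Real.rpow_mul hκ.le, Real.rpow_two, Real.rpow_sub (by positivity), Real.rpow_natCast]
    rw [hpow, pow_mul, div_pow]
    ring
  have hbase : κ ^ 2 + r ^ 2 = κ ^ 2 * (1 + r ^ 2 / κ ^ 2) := by field_simp
  rw [hsum, hbase, Real.mul_rpow (by positivity) (by positivity)]
  gcongr
  exact one_add_rpow_le_truncated_binomial hα hne J (by positivity)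

/-- For non-integer `α > d/2`, `κ > 0` and `K = ⌊α⌋ + 2J + 1` with `J ≥ 1`,
the reciprocal of the truncated spectral polynomial is Lebesgue integrable
on `ℝ^d`, and the polynomial is strictly positive everywhere. -/
theorem stmt_11 (d : ℕ) (hd : 1 ≤ d) (α : ℝ) (hα : (d : ℝ) / 2 < α)
    (hαni : ∀ n : ℤ, α ≠ (n : ℝ)) (κ : ℝ) (hκ : 0 < κ) (J : ℕ) (hJ : 1 ≤ J) :
    Integrable (fun ξ : EuclideanSpace ℝ (Fin d) =>
        (∑ k ∈ Finset.range (⌊α⌋₊ + 2 * J + 1 + 1),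
          a α k * κ ^ (2 * (α - (k : ℝ))) * ‖ξ‖ ^ (2 * k))⁻¹) ∧
      ∀ ξ : EuclideanSpace ℝ (Fin d),
        0 < ∑ k ∈ Finset.range (⌊α⌋₊ + 2 * J + 1 + 1),
          a α k * κ ^ (2 * (α - (k : ℝ))) * ‖ξ‖ ^ (2 * k) := by
  have hd' : (1 : ℝ) ≤ d := by exact_mod_cast hd
  have hα0 : 0 < α := by linarith
  have hne : α ≠ (⌊α⌋₊ : ℝ) := by exact_mod_cast hαni ⌊α⌋₊
  have hlower := fun ξ : EuclideanSpace ℝ (Fin d) =>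
    add_sq_rpow_le_truncated_symbol hα0.le hne hκ J ‖ξ‖
  have hpos : ∀ ξ : EuclideanSpace ℝ (Fin d),
      0 < ∑ k ∈ Finset.range (⌊α⌋₊ + 2 * J + 1 + 1),
        a α k * κ ^ (2 * (α - (k : ℝ))) * ‖ξ‖ ^ (2 * k) :=
    fun ξ => lt_of_lt_of_le (by positivity) (hlower ξ)
  refine ⟨?_, hpos⟩
  have hint : Integrable fun ξ : EuclideanSpace ℝ (Fin d) =>
      (min 1 (κ ^ 2)) ^ (-α) * (1 + ‖ξ‖ ^ 2) ^ (-(2 * α) / 2) :=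
    (integrable_rpow_neg_one_add_norm_sq (by rw [finrank_euclideanSpace_fin]; linarith)).const_mul _
  refine hint.mono' ?_ (Eventually.of_forall fun ξ => ?_)
  · exact (Continuous.measurable (by fun_prop)).inv.aestronglyMeasurable
  · have hmin : 0 < min 1 (κ ^ 2) := lt_min one_pos (by positivity)
    have hbase : min 1 (κ ^ 2) * (1 + ‖ξ‖ ^ 2) ≤ κ ^ 2 + ‖ξ‖ ^ 2 := by
      nlinarith [min_le_left 1 (κ ^ 2), min_le_right 1 (κ ^ 2), sq_nonneg ‖ξ‖]
    rw [Real.norm_of_nonneg (inv_pos.2 (hpos ξ)).le, show -(2 * α) / 2 = -α by ring,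
      ← Real.mul_rpow hmin.le (by positivity), Real.rpow_neg (by positivity)]
    exact inv_anti₀ (by positivity)
      ((Real.rpow_le_rpow (by positivity) hbase hα0.le).trans (hlower ξ))
end
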